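/- arXiv:math/0410004 — 3 statements merged into one kernel-verified Lean document; each statement's English description precedes it below -/
import Mathlib

section
/- For every ε with 11/16 ≤ ε ≤ 1, Δ(ε) = 2ε − 1; moreover, Δ(ε) ≥ 2ε − 1 for every ε with 1/2 ≤ ε ≤ 1. -/
open MeasureTheory

/-- A set `C ⊆ ℝ` is symmetric if there is a center `c` with `c + x ∈ C ↔ c - x ∈ C`. -/
def IsSymmetricSet (C : Set ℝ) : Prop := ∃ c : ℝ, ∀ x : ℝ, c + x ∈ C ↔ c - x ∈ C

/-- `DD A` is the supremum of measures of measurable symmetric subsets of `A`. -/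
noncomputable def DD (A : Set ℝ) : ℝ :=
  sSup {m : ℝ | ∃ C : Set ℝ, C ⊆ A ∧ MeasurableSet C ∧ IsSymmetricSet C ∧ m = (volume C).toReal}

/-- `Δ ε` is the infimum of `DD A` over measurable `A ⊆ [0,1)` with measure `ε`. -/
noncomputable def Δ (ε : ℝ) : ℝ :=
  sInf {d : ℝ | ∃ A : Set ℝ, A ⊆ Set.Ico (0:ℝ) 1 ∧ MeasurableSet A ∧
    volume A = ENNReal.ofReal ε ∧ d = DD A}

open Set

theorem volume_reflect (s : ℝ) {A : Set ℝ} (hA : MeasurableSet A) :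
    volume {x | s - x ∈ A} = volume A :=
  (Measure.measurePreserving_sub_left volume s).measure_preimage hA.nullMeasurableSet

theorem measureReal_reflect (s : ℝ) {A : Set ℝ} (hA : MeasurableSet A) :
    volume.real {x | s - x ∈ A} = volume.real A :=
  congrArg ENNReal.toReal (volume_reflect s hA)

theorem measurableSet_reflect (s : ℝ) {A : Set ℝ} (hA : MeasurableSet A) :
    MeasurableSet {x | s - x ∈ A} :=
  (measurable_const.sub measurable_id) hA

theorem volume_ne_top_of_subset_Ico {A : Set ℝ} {a b : ℝ} (hA : A ⊆ Ico a b) :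
    volume A ≠ ⊤ :=
  measure_ne_top_of_subset hA measure_Ico_lt_top.ne

/-- Symmetric subsets of `A` are bounded in measure by any bound on all the intersections of `A`
with its reflections. -/
theorem DD_le {A : Set ℝ} {a b : ℝ} (hA : A ⊆ Ico a b) {M : ℝ}
    (h : ∀ s, volume.real (A ∩ {x | s - x ∈ A}) ≤ M) : DD A ≤ M := by
  refine csSup_le ⟨_, ∅, empty_subset _, MeasurableSet.empty, ⟨0, by simp⟩, rfl⟩ ?_
  rintro _ ⟨C, hCA, -, ⟨c, hc⟩, rfl⟩
  refine le_trans (measureReal_mono ?_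
    (volume_ne_top_of_subset_Ico (inter_subset_left.trans hA))) (h (2 * c))
  intro x hx
  refine ⟨hCA hx, hCA ?_⟩
  have := (hc (x - c)).1 (by simpa using hx)
  rwa [show c - (x - c) = 2 * c - x by ring] at this

theorem DD_nonneg (A : Set ℝ) : 0 ≤ DD A := by
  refine Real.sSup_nonneg ?_
  rintro _ ⟨C, -, -, -, rfl⟩
  exact ENNReal.toReal_nonneg

theorem two_mul_sub_one_le_DD {A : Set ℝ} (hA : A ⊆ Ico 0 1) (hm : MeasurableSet A) :
    2 * volume.real A - 1 ≤ DD A := by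
  set R : Set ℝ := {x | 1 - x ∈ A} with hR
  have hRm : MeasurableSet R := measurableSet_reflect 1 hm
  have hbdd : BddAbove {m : ℝ | ∃ C : Set ℝ, C ⊆ A ∧ MeasurableSet C ∧ IsSymmetricSet C ∧
      m = (volume C).toReal} := by
    refine ⟨volume.real A, ?_⟩
    rintro _ ⟨C, hCA, -, -, rfl⟩
    exact measureReal_mono hCA (volume_ne_top_of_subset_Ico hA)
  have hle : volume.real (A ∩ R) ≤ DD A := by
    refine le_csSup hbdd ⟨A ∩ R, inter_subset_left, hm.inter hRm, ⟨1 / 2, fun x => ?_⟩, rfl⟩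
    simp only [hR, mem_inter_iff, mem_ofPred_eq]
    rw [show (1 : ℝ) - (1 / 2 + x) = 1 / 2 - x by ring,
      show (1 : ℝ) - (1 / 2 - x) = 1 / 2 + x by ring, and_comm]
  have hsub : A ∪ R ⊆ Icc 0 1 := by
    rintro x (hx | hx)
    · exact Ico_subset_Icc_self (hA hx)
    · have := hA hx
      constructor <;> linarith [this.1, this.2]
  have hunion : volume.real (A ∪ R) ≤ 1 := by
    refine (measureReal_mono hsub measure_Icc_lt_top.ne).trans ?_
    simp
  have hRtop : volume R ≠ ⊤ :=
    measure_ne_top_of_subset (subset_union_right.trans hsub) measure_Icc_lt_top.ne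
  have h1 := measureReal_union_add_inter (μ := volume) (s := A) hRm
    (volume_ne_top_of_subset_Ico hA) hRtop
  have h2 : volume.real R = volume.real A := measureReal_reflect 1 hm
  linarith

/-- Intermediate values of the measure between two nested bounded sets. -/
theorem exists_between_measureReal_eq {S U : Set ℝ} {a b m : ℝ} (hab : a ≤ b)
    (hU : U ⊆ Ico a b) (hSm : MeasurableSet S) (hUm : MeasurableSet U) (hSU : S ⊆ U)
    (h1 : volume.real S ≤ m) (h2 : m ≤ volume.real U) :
    ∃ T, S ⊆ T ∧ T ⊆ U ∧ MeasurableSet T ∧ volume.real T = m := by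
  let T : ℝ → Set ℝ := fun x => S ∪ (U ∩ Iio x)
  have hTU : ∀ x, T x ⊆ U := fun x => union_subset hSU inter_subset_left
  have hfin : ∀ x, volume (T x) ≠ ⊤ := fun x => volume_ne_top_of_subset_Ico ((hTU x).trans hU)
  have hmono : ∀ x y, x ≤ y → T x ⊆ T y := fun x y hxy =>
    union_subset_union_right _ (inter_subset_inter_right _ (Iio_subset_Iio hxy))
  have hstep : ∀ x y, x ≤ y → volume.real (T y) ≤ volume.real (T x) + (y - x) := by
    intro x y hxy
    have hsub : T y ⊆ T x ∪ Ico x y := by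
      rintro z (hz | ⟨hz, hzy⟩)
      · exact Or.inl (Or.inl hz)
      · rcases lt_or_ge z x with hzx | hzx
        · exact Or.inl (Or.inr ⟨hz, hzx⟩)
        · exact Or.inr ⟨hzx, hzy⟩
    calc volume.real (T y) ≤ volume.real (T x ∪ Ico x y) :=
          measureReal_mono hsub (measure_union_lt_top (hfin x).lt_top measure_Ico_lt_top).ne
      _ ≤ volume.real (T x) + volume.real (Ico x y) := measureReal_union_le _ _
      _ = _ := by rw [Real.volume_real_Ico_of_le hxy]
  have hcont : Continuous fun x => volume.real (T x) := by
    refine (LipschitzWith.of_le_add fun x y => ?_).continuous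
    rcases le_total x y with hxy | hxy
    · have := measureReal_mono (hmono x y hxy) (hfin y)
      linarith [dist_nonneg (x := x) (y := y)]
    · have := hstep y x hxy
      rwa [Real.dist_eq, abs_of_nonneg (sub_nonneg.2 hxy)]
  have hTa : T a = S := by
    refine (union_subset subset_rfl ?_).antisymm subset_union_left
    rintro z ⟨hz, hza⟩
    exact absurd (hU hz).1 (not_le.2 hza)
  have hTb : T b = U := (hTU b).antisymm fun z hz => Or.inr ⟨hz, (hU hz).2⟩
  obtain ⟨x, -, hx⟩ := intermediate_value_Icc hab hcont.continuousOn
    (show m ∈ Icc (volume.real (T a)) (volume.real (T b)) by rw [hTa, hTb]; exact ⟨h1, h2⟩)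
  exact ⟨T x, subset_union_left, hTU x, hSm.union (hUm.inter measurableSet_Iio), hx⟩

/-- Enlarging a set by measure `m` enlarges its intersection with a reflection by at
most `2 * m`. -/
theorem measureReal_inter_reflect_le_of_subset {A B : Set ℝ} {a b s : ℝ} (hB : B ⊆ Ico a b)
    (hAm : MeasurableSet A) (hBm : MeasurableSet B) (hAB : A ⊆ B) :
    volume.real (B ∩ {x | s - x ∈ B}) ≤
      volume.real (A ∩ {x | s - x ∈ A}) + 2 * (volume.real B - volume.real A) := by
  have hsub : B ∩ {x | s - x ∈ B} ⊆
      (A ∩ {x | s - x ∈ A}) ∪ ((B \ A) ∪ (B ∩ {x | s - x ∈ B \ A})) := by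
    rintro x ⟨hx, hsx⟩
    by_cases h1 : x ∈ A
    · by_cases h2 : s - x ∈ A
      · exact Or.inl ⟨h1, h2⟩
      · exact Or.inr (Or.inr ⟨hx, hsx, h2⟩)
    · exact Or.inr (Or.inl ⟨hx, h1⟩)
  have hdiff : volume.real (B \ A) = volume.real B - volume.real A :=
    measureReal_sdiff hAB hAm (volume_ne_top_of_subset_Ico hB)
  have hfin : volume ((A ∩ {x | s - x ∈ A}) ∪ ((B \ A) ∪ (B ∩ {x | s - x ∈ B \ A}))) ≠ ⊤ :=
    volume_ne_top_of_subset_Ico (union_subset (inter_subset_left.trans (hAB.trans hB))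
      (union_subset (sdiff_subset.trans hB) (inter_subset_left.trans hB)))
  have hrefl : volume.real (B ∩ {x | s - x ∈ B \ A}) ≤ volume.real (B \ A) := by
    rw [← measureReal_reflect s (hBm.diff hAm)]
    refine measureReal_mono inter_subset_right ?_
    rw [volume_reflect s (hBm.diff hAm)]
    exact volume_ne_top_of_subset_Ico (sdiff_subset.trans hB)
  have h1 := measureReal_mono (μ := volume) hsub hfin
  have h2 := measureReal_union_le (μ := volume) (A ∩ {x | s - x ∈ A})
    ((B \ A) ∪ (B ∩ {x | s - x ∈ B \ A}))
  have h3 := measureReal_union_le (μ := volume) (B \ A) (B ∩ {x | s - x ∈ B \ A})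
  linarith

/-- A set disjoint from its translate by `h` fills at most half of an interval, up to `h / 2`. -/
theorem measureReal_inter_Ico_le_of_disjoint_translate {T : Set ℝ} {h u v : ℝ} (hh : 0 ≤ h)
    (hTm : MeasurableSet T) (hT : ∀ x ∈ T, x + h ∉ T) (huv : u ≤ v) :
    volume.real (T ∩ Ico u v) ≤ (v - u) / 2 + h / 2 := by
  have hm : MeasurableSet (T ∩ Ico u v) := hTm.inter measurableSet_Ico
  set V : Set ℝ := {x | x - h ∈ T ∩ Ico u v} with hV
  have hVm : MeasurableSet V := (measurable_id.sub measurable_const) hm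
  have hVvol : volume V = volume (T ∩ Ico u v) :=
    (measurePreserving_sub_right (volume : Measure ℝ) h).measure_preimage hm.nullMeasurableSet
  have hdisj : Disjoint (T ∩ Ico u v) V := by
    rw [Set.disjoint_left]
    rintro x ⟨hx, -⟩ ⟨hx', -⟩
    exact hT _ hx' (by simpa using hx)
  have hsub : (T ∩ Ico u v) ∪ V ⊆ Ico u (v + h) := by
    rintro x (⟨-, hx⟩ | ⟨-, hx⟩)
    · exact ⟨hx.1, by linarith [hx.2]⟩
    · exact ⟨by linarith [hx.1], by linarith [hx.2]⟩
  have hfin : volume (T ∩ Ico u v) ≠ ⊤ := volume_ne_top_of_subset_Ico inter_subset_right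
  have h1 := measureReal_mono (μ := volume) hsub measure_Ico_lt_top.ne
  rw [measureReal_union hdisj hVm hfin (hVvol.trans_ne hfin),
    Real.volume_real_Ico_of_le (by linarith)] at h1
  have h2 : volume.real V = volume.real (T ∩ Ico u v) := congrArg ENNReal.toReal hVvol
  linarith

/-- The tent function of height and half-width `1 / 8`. -/
noncomputable def tent (u : ℝ) : ℝ := max 0 (1 / 8 - |u|)

theorem tent_nonneg (u : ℝ) : 0 ≤ tent u := le_max_left _ _

theorem sum_tent_le (s : ℝ) (n : ℕ) :
    ∑ k ∈ Finset.range n, tent (s - (k : ℝ) / 8) ≤ 1 / 8 := by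
  let f : ℝ → ℝ := fun u => max 0 (min (1 / 8) u)
  have htent : ∀ u, tent u = f (u + 1 / 8) - f u := by
    intro u
    simp only [tent, f]
    grind
  have hsum : ∑ k ∈ Finset.range n, tent (s - (k : ℝ) / 8) =
      f (s + 1 / 8) - f (s + 1 / 8 - (n : ℝ) / 8) := by
    induction n with
    | zero => simp
    | succ n ih =>
      rw [Finset.sum_range_succ, ih, htent]
      push_cast
      rw [show s - (n : ℝ) / 8 + 1 / 8 = s + 1 / 8 - n / 8 by ring,
        show s + 1 / 8 - ((n : ℝ) + 1) / 8 = s - n / 8 by ring]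
      ring
  rw [hsum]
  have h1 : f (s + 1 / 8) ≤ 1 / 8 := max_le (by norm_num) (min_le_left _ _)
  have h2 : 0 ≤ f (s + 1 / 8 - (n : ℝ) / 8) := le_max_left _ _
  linarith

/-- The `i`-th interval of length `1 / 8`. -/
def octant (i : ℕ) : Set ℝ := Ico ((i : ℝ) / 8) (((i : ℝ) + 1) / 8)

theorem octant_inter_reflect_subset (i j : ℕ) (s : ℝ) :
    octant i ∩ {x | s - x ∈ octant j} ⊆
      Icc (max ((i : ℝ) / 8) (s - ((j : ℝ) + 1) / 8))
        (min (((i : ℝ) + 1) / 8) (s - (j : ℝ) / 8)) := by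
  rintro x ⟨⟨h1, h2⟩, h3, h4⟩
  exact ⟨max_le h1 (by linarith), le_min h2.le (by linarith)⟩

theorem min_sub_max_eq (i j : ℕ) (s : ℝ) :
    min (((i : ℝ) + 1) / 8) (s - (j : ℝ) / 8) - max ((i : ℝ) / 8) (s - ((j : ℝ) + 1) / 8) =
      1 / 8 - |s - ((i + j + 1 : ℕ) : ℝ) / 8| := by
  push_cast
  grind

theorem measureReal_octant_inter_reflect_le (i j : ℕ) (s : ℝ) :
    volume.real (octant i ∩ {x | s - x ∈ octant j}) ≤ tent (s - ((i + j + 1 : ℕ) : ℝ) / 8) := by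
  refine (measureReal_mono (octant_inter_reflect_subset i j s) measure_Icc_lt_top.ne).trans ?_
  rw [Real.volume_real_Icc, min_sub_max_eq, max_comm, tent]

theorem measureReal_octant_inter_reflect_inter_le (i j : ℕ) (s : ℝ) {T : Set ℝ} {h : ℝ}
    (hh : 0 ≤ h) (hTm : MeasurableSet T) (hT : ∀ x ∈ T, x + h ∉ T) :
    volume.real (T ∩ (octant i ∩ {x | s - x ∈ octant j})) ≤
      1 / 2 * tent (s - ((i + j + 1 : ℕ) : ℝ) / 8) + h := by
  set u := max ((i : ℝ) / 8) (s - ((j : ℝ) + 1) / 8) with hu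
  set v := min (((i : ℝ) + 1) / 8) (s - (j : ℝ) / 8) with hv
  have hsub : octant i ∩ {x | s - x ∈ octant j} ⊆ Icc u v := octant_inter_reflect_subset i j s
  have htent : v - u ≤ tent (s - ((i + j + 1 : ℕ) : ℝ) / 8) :=
    (min_sub_max_eq i j s).trans_le (le_max_right _ _)
  rcases le_or_gt u v with huv | huv
  · have h1 : volume.real (T ∩ (octant i ∩ {x | s - x ∈ octant j})) ≤
        volume.real (T ∩ Ico u v) := by
      have : volume.real (T ∩ Icc u v) = volume.real (T ∩ Ico u v) :=
        measureReal_congr (Filter.EventuallyEq.rfl.inter Ico_ae_eq_Icc.symm)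
      rw [← this]
      exact measureReal_mono (inter_subset_inter_right _ hsub)
        (measure_ne_top_of_subset inter_subset_right measure_Icc_lt_top.ne)
    have h2 := measureReal_inter_Ico_le_of_disjoint_translate hh hTm hT huv
    linarith
  · rw [Icc_eq_empty (not_le.2 huv), subset_empty_iff] at hsub
    rw [hsub, inter_empty, measureReal_empty]
    linarith [tent_nonneg (s - ((i + j + 1 : ℕ) : ℝ) / 8)]

/-- The comb of period `2 * h` and density one half. -/
def comb (h : ℝ) : Set ℝ := {x | Int.fract (x / (2 * h)) < 1 / 2}

theorem measurableSet_comb (h : ℝ) : MeasurableSet (comb h) :=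
  measurableSet_lt (measurable_fract.comp (measurable_id.div_const _)) measurable_const

theorem add_mem_comb_iff {h : ℝ} (hh : 0 < h) (x : ℝ) : x + h ∈ comb h ↔ x ∉ comb h := by
  have e : (x + h) / (2 * h) = x / (2 * h) + 1 / 2 := by field_simp
  simp only [comb, mem_ofPred_eq, e, not_lt]
  set y := x / (2 * h)
  have h0 := Int.fract_nonneg y
  have h1 := Int.fract_lt_one y
  have hy := Int.floor_add_fract y
  rcases lt_or_ge (Int.fract y) (1 / 2) with h2 | h2
  · have : Int.fract (y + 1 / 2) = Int.fract y + 1 / 2 :=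
      Int.fract_eq_iff.2 ⟨by linarith, by linarith, ⌊y⌋, by linarith⟩
    rw [this]
    constructor <;> intro <;> linarith
  · have : Int.fract (y + 1 / 2) = Int.fract y - 1 / 2 :=
      Int.fract_eq_iff.2 ⟨by linarith, by linarith, ⌊y⌋ + 1, by push_cast; linarith⟩
    rw [this]
    constructor <;> intro <;> linarith

/-- The `i`-th piece of the extremal set: a full octant, except that the one with index `5` is
thinned out by a comb. -/
def piece (h : ℝ) (i : ℕ) : Set ℝ := if i = 5 then comb h ∩ octant i else octant i

/-- A nearly extremal set, of measure close to `11 / 16`. -/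
def combSet (h : ℝ) : Set ℝ := ⋃ i ∈ ({0, 1, 2, 4, 5, 7} : Finset ℕ), piece h i

theorem piece_subset_octant (h : ℝ) (i : ℕ) : piece h i ⊆ octant i := by
  unfold piece
  split_ifs
  · exact inter_subset_right
  · exact subset_rfl

theorem measurableSet_piece (h : ℝ) (i : ℕ) : MeasurableSet (piece h i) := by
  unfold piece
  split_ifs
  · exact (measurableSet_comb h).inter measurableSet_Ico
  · exact measurableSet_Ico

theorem measurableSet_combSet (h : ℝ) : MeasurableSet (combSet h) :=
  Finset.measurableSet_biUnion _ fun i _ => measurableSet_piece h i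

theorem combSet_subset (h : ℝ) : combSet h ⊆ Ico 0 1 := by
  refine iUnion₂_subset fun i hi => (piece_subset_octant h i).trans ?_
  have hi7 : i ≤ 7 := by
    simp only [Finset.mem_insert, Finset.mem_singleton] at hi
    omega
  have hi7' : (i : ℝ) ≤ 7 := by exact_mod_cast hi7
  exact Ico_subset_Ico (by positivity) (by linarith)

theorem measureReal_piece_inter_reflect_le {h : ℝ} (hh : 0 < h) (i j : ℕ) (s : ℝ) :
    volume.real (piece h i ∩ {x | s - x ∈ piece h j}) ≤
      (if i = 5 ∨ j = 5 then 1 / 2 else 1) * tent (s - ((i + j + 1 : ℕ) : ℝ) / 8) + h := by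
  have hfin : volume (octant i ∩ {x | s - x ∈ octant j}) ≠ ⊤ :=
    volume_ne_top_of_subset_Ico inter_subset_left
  have hsub : piece h i ∩ {x | s - x ∈ piece h j} ⊆ octant i ∩ {x | s - x ∈ octant j} :=
    fun x hx => ⟨piece_subset_octant h i hx.1, piece_subset_octant h j hx.2⟩
  by_cases hi : i = 5
  · rw [if_pos (Or.inl hi)]
    have hsub' : piece h i ∩ {x | s - x ∈ piece h j} ⊆
        comb h ∩ (octant i ∩ {x | s - x ∈ octant j}) := by
      refine subset_inter (inter_subset_left.trans ?_) hsub
      rw [piece, if_pos hi]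
      exact inter_subset_left
    exact (measureReal_mono hsub' (measure_ne_top_of_subset inter_subset_right hfin)).trans
      (measureReal_octant_inter_reflect_inter_le i j s hh.le (measurableSet_comb h)
        fun x hx hx' => (add_mem_comb_iff hh x).1 hx' hx)
  · by_cases hj : j = 5
    · rw [if_pos (Or.inr hj)]
      have hsub' : piece h i ∩ {x | s - x ∈ piece h j} ⊆
          {x | s - x ∈ comb h} ∩ (octant i ∩ {x | s - x ∈ octant j}) := by
        refine subset_inter (inter_subset_right.trans fun x hx => ?_) hsub
        rw [mem_ofPred_eq, piece, if_pos hj] at hx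
        exact hx.1
      refine (measureReal_mono hsub' (measure_ne_top_of_subset inter_subset_right hfin)).trans
        (measureReal_octant_inter_reflect_inter_le i j s hh.le
          (measurableSet_reflect s (measurableSet_comb h)) fun x hx hx' => ?_)
      refine (add_mem_comb_iff hh (s - (x + h))).1 ?_ hx'
      rw [sub_add_eq_sub_sub, sub_add_cancel]
      exact hx
    · rw [if_neg (not_or.2 ⟨hi, hj⟩), one_mul]
      have h1 := measureReal_mono hsub hfin
      have h2 := measureReal_octant_inter_reflect_le i j s
      linarith

theorem measureReal_combSet_inter_reflect_le {h : ℝ} (hh : 0 < h) (s : ℝ) :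
    volume.real (combSet h ∩ {x | s - x ∈ combSet h}) ≤ 3 / 8 + 36 * h := by
  set I : Finset ℕ := {0, 1, 2, 4, 5, 7} with hI
  have hsub : combSet h ∩ {x | s - x ∈ combSet h} ⊆
      ⋃ p ∈ I ×ˢ I, piece h p.1 ∩ {x | s - x ∈ piece h p.2} := by
    rintro x ⟨hx, hsx⟩
    simp only [combSet, mem_ofPred_eq, mem_iUnion, exists_prop] at hx hsx
    obtain ⟨i, hi, hx⟩ := hx
    obtain ⟨j, hj, hsx⟩ := hsx
    simp only [mem_iUnion]
    exact ⟨(i, j), Finset.mem_product.2 ⟨hi, hj⟩, hx, hsx⟩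
  have hfin : volume (⋃ p ∈ I ×ˢ I, piece h p.1 ∩ {x | s - x ∈ piece h p.2}) ≠ ⊤ := by
    refine (measure_biUnion_lt_top (I ×ˢ I).finite_toSet fun p _ => ?_).ne
    exact (volume_ne_top_of_subset_Ico
      (inter_subset_left.trans (piece_subset_octant h p.1))).lt_top
  have hsum : volume.real (combSet h ∩ {x | s - x ∈ combSet h}) ≤
      ∑ p ∈ I ×ˢ I, ((if p.1 = 5 ∨ p.2 = 5 then 1 / 2 else 1) *
        tent (s - ((p.1 + p.2 + 1 : ℕ) : ℝ) / 8) + h) :=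
    (measureReal_mono hsub hfin).trans ((measureReal_biUnion_finset_le _ _).trans
      (Finset.sum_le_sum fun p _ => measureReal_piece_inter_reflect_le hh p.1 p.2 s))
  refine hsum.trans ?_
  have htent := sum_tent_le s 16
  have hnn : ∀ k : ℕ, 0 ≤ tent (s - (k : ℝ) / 8) := fun k => tent_nonneg _
  generalize hg : (fun k : ℕ => tent (s - (k : ℝ) / 8)) = g at *
  have hg' : ∀ k : ℕ, tent (s - (k : ℝ) / 8) = g k := fun k => congrFun hg k
  simp only [hg'] at hnn htent ⊢
  rw [Finset.sum_product, hI]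
  simp only [Finset.sum_range_succ, Finset.sum_range_zero] at htent
  simp
  linarith [hnn 0, hnn 1, hnn 2, hnn 3, hnn 4, hnn 5, hnn 6, hnn 7, hnn 8, hnn 9, hnn 10,
    hnn 11, hnn 12, hnn 13, hnn 14, hnn 15]

theorem le_measureReal_combSet {h : ℝ} (hh : 0 < h) :
    11 / 16 - h ≤ volume.real (combSet h) := by
  have hdisj : Set.PairwiseDisjoint (({0, 1, 2, 4, 5, 7} : Finset ℕ) : Set ℕ) (piece h) := by
    intro i _ j _ hij
    refine Disjoint.mono (piece_subset_octant h i) (piece_subset_octant h j) ?_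
    rw [Set.disjoint_left]
    rintro x ⟨h1, h2⟩ ⟨h3, h4⟩
    have h5 : (i : ℝ) < j + 1 := by linarith
    have h6 : (j : ℝ) < i + 1 := by linarith
    norm_cast at h5 h6
    omega
  have hcomb : 1 / 16 - h ≤ volume.real (comb h ∩ octant 5) := by
    have h1 := measureReal_inter_Ico_le_of_disjoint_translate (T := (comb h)ᶜ) (u := (5 : ℕ) / 8)
      (v := ((5 : ℕ) + 1) / 8) hh.le (measurableSet_comb h).compl
      (fun x hx hx' => hx' ((add_mem_comb_iff hh x).2 hx)) (by norm_num)
    have h2 := measureReal_inter_add_sdiff (μ := volume) (s := octant 5) (measurableSet_comb h)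
      measure_Ico_lt_top.ne
    have h3 : octant 5 \ comb h = (comb h)ᶜ ∩ octant 5 := by rw [sdiff_eq, inter_comm]
    have h4 : volume.real (octant 5) = 1 / 8 := by
      rw [octant, Real.volume_real_Ico_of_le] <;> norm_num
    rw [h3, h4, inter_comm] at h2
    change volume.real ((comb h)ᶜ ∩ octant 5) ≤ _ at h1
    norm_num at h1
    linarith
  have hoct : ∀ i : ℕ, volume.real (octant i) = 1 / 8 := by
    intro i
    rw [octant, Real.volume_real_Ico_of_le (by linarith)]
    ring
  rw [combSet, measureReal_biUnion_finset hdisj (fun i _ => measurableSet_piece h i)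
    (fun i _ => volume_ne_top_of_subset_Ico (piece_subset_octant h i))]
  simp [piece, hoct]
  linarith

theorem two_mul_sub_one_le_Δ {ε : ℝ} (h0 : 0 ≤ ε) (h1 : ε ≤ 1) : 2 * ε - 1 ≤ Δ ε := by
  refine le_csInf ⟨_, Ico 0 ε, Ico_subset_Ico_right h1, measurableSet_Ico, by simp, rfl⟩ ?_
  rintro _ ⟨A, hA, hm, hv, rfl⟩
  have : volume.real A = ε := by rw [Measure.real, hv, ENNReal.toReal_ofReal h0]
  rw [← this]
  exact two_mul_sub_one_le_DD hA hm

theorem Δ_le_two_mul_sub_one {ε : ℝ} (h0 : 11 / 16 ≤ ε) (h1 : ε ≤ 1) : Δ ε ≤ 2 * ε - 1 := by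
  refine le_of_forall_pos_le_add fun η hη => ?_
  set h := η / 38 with hh_def
  have hh : 0 < h := by positivity
  have hbound := measureReal_combSet_inter_reflect_le hh
  have hle : ∀ A ⊆ Ico (0 : ℝ) 1, MeasurableSet A → volume.real A = ε →
      (∀ s, volume.real (A ∩ {x | s - x ∈ A}) ≤ 2 * ε - 1 + η) → Δ ε ≤ 2 * ε - 1 + η := by
    intro A hA hm hv hs
    refine le_trans ?_ (DD_le hA hs)
    refine csInf_le ⟨0, ?_⟩ ⟨A, hA, hm, ?_, rfl⟩
    · rintro _ ⟨B, -, -, -, rfl⟩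
      exact DD_nonneg B
    · rw [← hv, Measure.real, ENNReal.ofReal_toReal (volume_ne_top_of_subset_Ico hA)]
  rcases le_total (volume.real (combSet h)) ε with hε | hε
  · obtain ⟨A, hSA, hA, hm, hv⟩ := exists_between_measureReal_eq zero_le_one subset_rfl
      (measurableSet_combSet h) measurableSet_Ico (combSet_subset h) hε (by simpa using h1)
    refine hle A hA hm hv fun s => ?_
    have h2 := measureReal_inter_reflect_le_of_subset (s := s) hA (measurableSet_combSet h) hm hSA
    have h3 := le_measureReal_combSet hh
    linarith [hbound s]
  · obtain ⟨A, -, hA, hm, hv⟩ := exists_between_measureReal_eq zero_le_one (combSet_subset h)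
      MeasurableSet.empty (measurableSet_combSet h) (empty_subset _)
      (by simpa using (by linarith : 0 ≤ ε)) hε
    refine hle A (hA.trans (combSet_subset h)) hm hv fun s => ?_
    have h2 : volume.real (A ∩ {x | s - x ∈ A}) ≤
        volume.real (combSet h ∩ {x | s - x ∈ combSet h}) :=
      measureReal_mono (inter_subset_inter hA fun x hx => hA hx)
        (volume_ne_top_of_subset_Ico (inter_subset_left.trans (combSet_subset h)))
    linarith [hbound s]

theorem delta_eq_two_eps_sub_one :
    (∀ ε : ℝ, 11/16 ≤ ε → ε ≤ 1 → Δ ε = 2*ε - 1) ∧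
    (∀ ε : ℝ, 1/2 ≤ ε → ε ≤ 1 → 2*ε - 1 ≤ Δ ε) := by
  exact ⟨fun ε h0 h1 => le_antisymm (Δ_le_two_mul_sub_one h0 h1)
      (two_mul_sub_one_le_Δ (by linarith) h1),
    fun ε h0 h1 => two_mul_sub_one_le_Δ (by linarith) h1⟩
end

section
/- Δ(ε) ≥ 0.591389 ε² for all 0 < ε ≤ 1. -/
open MeasureTheory

/-- The character `x ↦ exp (i π n x)` of period `2`. -/
noncomputable def wave (n : ℤ) (x : ℝ) : ℂ := Complex.exp (Real.pi * n * x * Complex.I)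

/-- The autoconvolution of the indicator function of `A`. -/
noncomputable def selfConv (A : Set ℝ) (x : ℝ) : ℝ := volume.real (A ∩ {t | x - t ∈ A})

lemma wave_add (n : ℤ) (x y : ℝ) : wave n (x + y) = wave n x * wave n y := by
  rw [wave, wave, wave, ← Complex.exp_add]
  congr 1
  push_cast
  ring

lemma norm_wave (n : ℤ) (x : ℝ) : ‖wave n x‖ = 1 := by
  have : wave n x = Complex.exp ((Real.pi * n * x : ℝ) * Complex.I) := by simp [wave]
  rw [this, Complex.norm_exp_ofReal_mul_I]

lemma wave_re (n : ℤ) (x : ℝ) : (wave n x).re = Real.cos (n * (Real.pi * x)) := by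
  have : wave n x = Complex.exp ((n * (Real.pi * x) : ℝ) * Complex.I) := by
    simp [wave]; ring_nf
  rw [this, Complex.exp_ofReal_mul_I_re]

lemma wave_zero (x : ℝ) : wave 0 x = 1 := by simp [wave]

lemma wave_neg (n : ℤ) (x : ℝ) : wave (-n) x = (starRingEnd ℂ) (wave n x) := by
  rw [wave, wave, ← Complex.exp_conj]
  congr 1
  simp

@[fun_prop]
lemma continuous_wave (n : ℤ) : Continuous (wave n) := by
  unfold wave
  fun_prop

lemma measurableSet_inter_reflect {A : Set ℝ} (hA : MeasurableSet A) (x : ℝ) :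
    MeasurableSet (A ∩ {t | x - t ∈ A}) :=
  hA.inter ((measurable_const.sub measurable_id) hA)

lemma integrableOn_wave {A : Set ℝ} (hfin : volume A ≠ ⊤) (n : ℤ) : IntegrableOn (wave n) A :=
  Measure.integrableOn_of_bounded hfin (continuous_wave n).aestronglyMeasurable
    (.of_forall fun x => (norm_wave n x).le)

lemma integrable_indicator_wave {A : Set ℝ} (hA : MeasurableSet A) (hfin : volume A ≠ ⊤) (n : ℤ) :
    Integrable (A.indicator (wave n)) := by
  rw [integrable_indicator_iff hA]
  exact integrableOn_wave hfin n

open scoped Convolution in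
lemma convolution_indicator_wave {A : Set ℝ} (hA : MeasurableSet A) (n : ℤ) (x : ℝ) :
    (A.indicator (wave n) ⋆[ContinuousLinearMap.mul ℝ ℂ, volume] A.indicator (wave n)) x
      = selfConv A x * wave n x := by
  have key : ∀ t, ContinuousLinearMap.mul ℝ ℂ (A.indicator (wave n) t)
      (A.indicator (wave n) (x - t))
      = (A ∩ {t | x - t ∈ A}).indicator (fun _ => wave n x) t := by
    intro t
    by_cases h1 : t ∈ A <;> by_cases h2 : x - t ∈ A <;> simp [h1, h2, ← wave_add]
  rw [convolution_def]
  simp_rw [key]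
  rw [integral_indicator_const _ (measurableSet_inter_reflect hA x), selfConv, Complex.real_smul]

lemma integrable_selfConv_mul_wave {A : Set ℝ} (hA : MeasurableSet A) (hfin : volume A ≠ ⊤)
    (n : ℤ) : Integrable fun x => (selfConv A x : ℂ) * wave n x := by
  have hi := integrable_indicator_wave hA hfin n
  refine (hi.integrable_convolution (ContinuousLinearMap.mul ℝ ℂ) hi).congr (.of_forall fun x => ?_)
  exact convolution_indicator_wave hA n x

lemma integral_selfConv_mul_wave {A : Set ℝ} (hA : MeasurableSet A) (hfin : volume A ≠ ⊤)
    (n : ℤ) : ∫ x, (selfConv A x : ℂ) * wave n x = (∫ t in A, wave n t) ^ 2 := by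
  have hi := integrable_indicator_wave hA hfin n
  have := integral_convolution (ContinuousLinearMap.mul ℝ ℂ) hi hi
  simp_rw [convolution_indicator_wave hA, integral_indicator hA] at this
  rw [this, ContinuousLinearMap.mul_apply', sq]

lemma integrable_selfConv {A : Set ℝ} (hA : MeasurableSet A) (hfin : volume A ≠ ⊤) :
    Integrable (selfConv A) := by
  simpa [wave_zero] using (integrable_selfConv_mul_wave hA hfin 0).re

lemma selfConv_eq_zero {A : Set ℝ} (hA : A ⊆ Set.Ico (-1 / 2) (1 / 2)) {x : ℝ}
    (hx : x ∉ Set.Ioc (-1 : ℝ) 1) (hx1 : x ≠ -1) : selfConv A x = 0 := by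
  have : A ∩ {t | x - t ∈ A} = ∅ := by
    ext t
    simp only [Set.mem_inter_iff, Set.mem_ofPred_eq, Set.mem_empty_iff_false, iff_false, not_and]
    intro h1 h2
    obtain ⟨h3, h4⟩ := hA h1
    obtain ⟨h5, h6⟩ := hA h2
    exact hx ⟨lt_of_le_of_ne (by linarith) (Ne.symm hx1), by linarith⟩
  simp [selfConv, this]

lemma intervalIntegral_selfConv_mul {A : Set ℝ} (hA : A ⊆ Set.Ico (-1 / 2) (1 / 2)) {E : Type*}
    [NormedRing E] [NormedAlgebra ℝ E] (g : ℝ → E) :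
    ∫ x in (-1 : ℝ)..1, selfConv A x • g x = ∫ x, selfConv A x • g x := by
  rw [intervalIntegral.integral_of_le (by norm_num), ← integral_Icc_eq_integral_Ioc]
  apply setIntegral_eq_integral_of_forall_compl_eq_zero
  intro x hx
  rw [selfConv_eq_zero hA (fun h => hx ⟨h.1.le, h.2⟩) (by rintro rfl; exact hx (by norm_num)),
    zero_smul]

lemma integrable_selfConv_mul_cos {A : Set ℝ} (hm : MeasurableSet A) (hfin : volume A ≠ ⊤)
    (n : ℤ) : Integrable fun x => selfConv A x * Real.cos (n * (Real.pi * x)) := by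
  simpa [wave_re] using (integrable_selfConv_mul_wave hm hfin n).re

lemma integral_selfConv_mul_cos {A : Set ℝ} (hm : MeasurableSet A) (hfin : volume A ≠ ⊤) (n : ℤ) :
    ∫ x, selfConv A x * Real.cos (n * (Real.pi * x)) = ((∫ t in A, wave n t) ^ 2).re := by
  have h := integral_re (integrable_selfConv_mul_wave hm hfin n)
  rw [integral_selfConv_mul_wave hm hfin n] at h
  simpa [wave_re] using h

lemma integrableOn_cos {A : Set ℝ} (hfin : volume A ≠ ⊤) (n : ℤ) :
    IntegrableOn (fun t => Real.cos (n * (Real.pi * t))) A := by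
  simpa [wave_re, IntegrableOn] using (integrableOn_wave hfin n).re

lemma re_integral_wave {A : Set ℝ} (hfin : volume A ≠ ⊤) (n : ℤ) :
    (∫ t in A, wave n t).re = ∫ t in A, Real.cos (n * (Real.pi * t)) := by
  have h := integral_re (integrableOn_wave hfin n)
  simpa [wave_re] using h.symm

lemma norm_integral_wave_neg (A : Set ℝ) (n : ℤ) :
    ‖∫ t in A, wave (-n) t‖ = ‖∫ t in A, wave n t‖ := by
  simp_rw [wave_neg]
  rw [integral_conj, RCLike.norm_conj]

lemma norm_fourierCoeffOn_selfConv {A : Set ℝ} (hm : MeasurableSet A)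
    (hA : A ⊆ Set.Ico (-1 / 2) (1 / 2)) (hfin : volume A ≠ ⊤) (n : ℤ) :
    ‖fourierCoeffOn (show (-1 : ℝ) < 1 by norm_num) (fun x => (selfConv A x : ℂ)) n‖
      = ‖∫ t in A, wave n t‖ ^ 2 / 2 := by
  have h : ∀ x : ℝ, fourier (-n) (x : AddCircle (1 - (-1) : ℝ)) • (selfConv A x : ℂ)
      = selfConv A x • wave (-n) x := by
    intro x
    rw [fourier_coe_apply, wave, Complex.real_smul, smul_eq_mul, mul_comm]
    congr 2
    push_cast
    ring
  rw [fourierCoeffOn_eq_integral]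
  simp_rw [h]
  rw [intervalIntegral_selfConv_mul hA]
  simp_rw [Complex.real_smul]
  rw [integral_selfConv_mul_wave hm hfin, norm_mul, norm_pow, norm_integral_wave_neg]
  norm_num
  ring

lemma sum_norm_pow_four_le {A : Set ℝ} (hm : MeasurableSet A)
    (hA : A ⊆ Set.Ico (-1 / 2) (1 / 2)) (hfin : volume A ≠ ⊤) (s : Finset ℤ) :
    ∑ n ∈ s, ‖∫ t in A, wave n t‖ ^ 4 ≤ 2 * ∫ x in (-1 : ℝ)..1, selfConv A x ^ 2 := by
  have hbound : ∀ x, ‖(selfConv A x : ℂ)‖ ≤ volume.real A := fun x => by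
    rw [Complex.norm_real, selfConv, Real.norm_of_nonneg measureReal_nonneg]
    exact measureReal_mono Set.inter_subset_left hfin
  have hL2 : MemLp (fun x => (selfConv A x : ℂ)) 2 (volume.restrict (Set.Ioc (-1 : ℝ) 1)) :=
    MemLp.of_bound (integrable_selfConv hm hfin).ofReal.aestronglyMeasurable.restrict _
      (.of_forall hbound)
  have hs := hasSum_sq_fourierCoeffOn (show (-1 : ℝ) < 1 by norm_num) hL2
  have hle := sum_le_hasSum s (fun _ _ => by positivity) hs
  simp only [norm_fourierCoeffOn_selfConv hm hA hfin, Complex.norm_real, Real.norm_eq_abs, sq_abs,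
    smul_eq_mul] at hle
  have h4 : ∀ n : ℤ, ‖∫ t in A, wave n t‖ ^ 4 = 4 * (‖∫ t in A, wave n t‖ ^ 2 / 2) ^ 2 :=
    fun n => by ring
  simp_rw [h4, ← Finset.mul_sum]
  linarith

lemma cos_four_mul (θ : ℝ) : Real.cos (4 * θ) = 8 * Real.cos θ ^ 4 - 8 * Real.cos θ ^ 2 + 1 := by
  rw [show 4 * θ = 2 * (2 * θ) by ring, Real.cos_two_mul, Real.cos_two_mul]
  ring

lemma cos_five_mul (θ : ℝ) :
    Real.cos (5 * θ) = 16 * Real.cos θ ^ 5 - 20 * Real.cos θ ^ 3 + 5 * Real.cos θ := by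
  have h := Real.cos_add_cos (5 * θ) θ
  rw [show (5 * θ + θ) / 2 = 3 * θ by ring, show (5 * θ - θ) / 2 = 2 * θ by ring,
    Real.cos_three_mul, Real.cos_two_mul] at h
  linear_combination h

lemma sum_cos_eq_kernel (θ : ℝ) :
    22 + 39 * Real.cos θ + 30 * Real.cos (2 * θ) + 21 * Real.cos (3 * θ) + 12 * Real.cos (4 * θ)
      + 4 * Real.cos (5 * θ)
      = 4 * (1 + Real.cos θ) * (4 * Real.cos θ ^ 2 + Real.cos θ - 1) ^ 2 := by
  rw [cos_four_mul, cos_five_mul, Real.cos_two_mul, Real.cos_three_mul]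
  ring

lemma le_sum_cos {θ : ℝ} (h : 0 ≤ Real.cos θ) :
    126 ≤ 207 * Real.cos θ - 98 * Real.cos (2 * θ) + Real.cos (3 * θ) + 28 * Real.cos (4 * θ)
      - 12 * Real.cos (5 * θ) := by
  have hn : 0 ≤ 4 * Real.cos θ * (1 - Real.cos θ) * (4 * Real.cos θ - 3) ^ 2
      * (4 + 3 * Real.cos θ) := by
    have := Real.cos_le_one θ
    have h1 : 0 ≤ 1 - Real.cos θ := by linarith
    positivity
  rw [cos_four_mul, cos_five_mul, Real.cos_two_mul, Real.cos_three_mul]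
  linear_combination hn

lemma integral_cos_mul_pi {n : ℤ} (hn : n ≠ 0) :
    ∫ x in (-1 : ℝ)..1, Real.cos (n * (Real.pi * x)) = 0 := by
  have h0 : (n : ℝ) * Real.pi ≠ 0 := mul_ne_zero (by exact_mod_cast hn) Real.pi_ne_zero
  simp_rw [← mul_assoc]
  rw [intervalIntegral.integral_comp_mul_left (fun y => Real.cos y) h0, integral_cos]
  simp [Real.sin_int_mul_pi]

/-- The nonnegative trigonometric polynomial tested against the autoconvolution. -/
noncomputable def kernel (x : ℝ) : ℝ :=
  22 + 39 * Real.cos ((1 : ℤ) * (Real.pi * x)) + 30 * Real.cos ((2 : ℤ) * (Real.pi * x))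
    + 21 * Real.cos ((3 : ℤ) * (Real.pi * x)) + 12 * Real.cos ((4 : ℤ) * (Real.pi * x))
    + 4 * Real.cos ((5 : ℤ) * (Real.pi * x))

lemma kernel_nonneg (x : ℝ) : 0 ≤ kernel x := by
  have h := sum_cos_eq_kernel (Real.pi * x)
  have h1 : 0 ≤ 1 + Real.cos (Real.pi * x) := by linarith [Real.neg_one_le_cos (Real.pi * x)]
  have h2 : kernel x = 4 * (1 + Real.cos (Real.pi * x))
      * (4 * Real.cos (Real.pi * x) ^ 2 + Real.cos (Real.pi * x) - 1) ^ 2 := by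
    rw [← h]
    simp [kernel]
  rw [h2]
  positivity

lemma continuous_kernel : Continuous kernel := by
  unfold kernel
  fun_prop

lemma integral_kernel : ∫ x in (-1 : ℝ)..1, kernel x = 44 := by
  have hi : ∀ (c : ℝ) (n : ℤ), IntervalIntegrable
      (fun x : ℝ => c * Real.cos (n * (Real.pi * x))) volume (-1) 1 :=
    fun c n => Continuous.intervalIntegrable (by fun_prop) _ _
  have hc : IntervalIntegrable (fun _ : ℝ => (22 : ℝ)) volume (-1) 1 := intervalIntegrable_const
  have h1 := hc.add (hi 39 1)
  have h2 := h1.add (hi 30 2)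
  have h3 := h2.add (hi 21 3)
  have h4 := h3.add (hi 12 4)
  unfold kernel
  rw [intervalIntegral.integral_add h4 (hi 4 5), intervalIntegral.integral_add h3 (hi 12 4),
    intervalIntegral.integral_add h2 (hi 21 3), intervalIntegral.integral_add h1 (hi 30 2),
    intervalIntegral.integral_add hc (hi 39 1)]
  simp only [intervalIntegral.integral_const_mul]
  rw [integral_cos_mul_pi one_ne_zero, integral_cos_mul_pi two_ne_zero,
    integral_cos_mul_pi three_ne_zero, integral_cos_mul_pi four_ne_zero,
    integral_cos_mul_pi (by norm_num : (5 : ℤ) ≠ 0)]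
  norm_num

lemma integral_wave_zero (A : Set ℝ) : ∫ t in A, wave 0 t = (volume.real A : ℂ) := by
  simp [wave_zero]

lemma integral_selfConv {A : Set ℝ} (hm : MeasurableSet A) (hfin : volume A ≠ ⊤) :
    ∫ x, selfConv A x = volume.real A ^ 2 := by
  have h := integral_selfConv_mul_cos hm hfin 0
  rw [integral_wave_zero, ← Complex.ofReal_pow, Complex.ofReal_re] at h
  simpa using h

lemma integral_selfConv_mul_kernel {A : Set ℝ} (hm : MeasurableSet A) (hfin : volume A ≠ ⊤) :
    ∫ x, selfConv A x * kernel x = 22 * volume.real A ^ 2 + 39 * ((∫ t in A, wave 1 t) ^ 2).re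
      + 30 * ((∫ t in A, wave 2 t) ^ 2).re + 21 * ((∫ t in A, wave 3 t) ^ 2).re
      + 12 * ((∫ t in A, wave 4 t) ^ 2).re + 4 * ((∫ t in A, wave 5 t) ^ 2).re := by
  have hi : ∀ (c : ℝ) (n : ℤ), Integrable
      (fun x : ℝ => c * (selfConv A x * Real.cos (n * (Real.pi * x)))) :=
    fun c n => (integrable_selfConv_mul_cos hm hfin n).const_mul c
  have hc : Integrable (fun x : ℝ => 22 * selfConv A x) :=
    (integrable_selfConv hm hfin).const_mul _
  have h1 := hc.add (hi 39 1)
  have h2 := h1.add (hi 30 2)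
  have h3 := h2.add (hi 21 3)
  have h4 := h3.add (hi 12 4)
  simp_rw [← integral_selfConv_mul_cos hm hfin, ← integral_selfConv hm hfin,
    ← integral_const_mul]
  rw [← integral_add' hc (hi 39 1), ← integral_add' h1 (hi 30 2), ← integral_add' h2 (hi 21 3),
    ← integral_add' h3 (hi 12 4), ← integral_add' h4 (hi 4 5)]
  refine integral_congr_ae (.of_forall fun x => ?_)
  simp only [kernel, Pi.add_apply]
  ring

lemma sum_re_integral_wave_ge {A : Set ℝ} (hm : MeasurableSet A)
    (hA : A ⊆ Set.Ico (-1 / 2) (1 / 2)) (hfin : volume A ≠ ⊤) :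
    126 * volume.real A ≤ 207 * (∫ t in A, wave 1 t).re - 98 * (∫ t in A, wave 2 t).re
      + (∫ t in A, wave 3 t).re + 28 * (∫ t in A, wave 4 t).re
      - 12 * (∫ t in A, wave 5 t).re := by
  have hi : ∀ (c : ℝ) (n : ℤ), IntegrableOn
      (fun x : ℝ => c * Real.cos (n * (Real.pi * x))) A :=
    fun c n => (integrableOn_cos hfin n).const_mul c
  have h2 := (hi 207 1).sub (hi 98 2)
  have h3 := h2.add (integrableOn_cos hfin 3)
  have h4 := h3.add (hi 28 4)
  have h5 := h4.sub (hi 12 5)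
  simp_rw [re_integral_wave hfin, ← integral_const_mul]
  rw [← integral_sub' (hi 207 1) (hi 98 2), ← integral_add' h2 (integrableOn_cos hfin 3),
    ← integral_add' h3 (hi 28 4), ← integral_sub' h4 (hi 12 5)]
  have hconst : 126 * volume.real A = ∫ _ in A, (126 : ℝ) := by
    simp [mul_comm]
  rw [hconst]
  refine setIntegral_mono_on (integrableOn_const hfin) h5 hm fun t ht => ?_
  obtain ⟨h6, h7⟩ := hA ht
  have hcos : 0 ≤ Real.cos (Real.pi * t) :=
    Real.cos_nonneg_of_mem_Icc ⟨by nlinarith [Real.pi_pos], by nlinarith [Real.pi_pos]⟩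
  simpa using le_sum_cos hcos

lemma selfConv_nonneg (A : Set ℝ) (x : ℝ) : 0 ≤ selfConv A x := measureReal_nonneg

lemma integral_selfConv_sq_le {A : Set ℝ} (hm : MeasurableSet A)
    (hA : A ⊆ Set.Ico (-1 / 2) (1 / 2)) (hfin : volume A ≠ ⊤) {D : ℝ}
    (hD : ∀ x, selfConv A x ≤ D) :
    ∫ x in (-1 : ℝ)..1, selfConv A x ^ 2 ≤ D * volume.real A ^ 2 := by
  have h := intervalIntegral_selfConv_mul hA (selfConv A)
  simp only [smul_eq_mul, ← sq] at h
  rw [h, ← integral_selfConv hm hfin, ← integral_const_mul]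
  refine integral_mono_of_nonneg (.of_forall fun x => sq_nonneg _)
    ((integrable_selfConv hm hfin).const_mul D) (.of_forall fun x => ?_)
  simp only [sq]
  exact mul_le_mul_of_nonneg_right (hD x) (selfConv_nonneg A x)

lemma integral_selfConv_mul_kernel_le {A : Set ℝ} (hA : A ⊆ Set.Ico (-1 / 2) (1 / 2)) {D : ℝ}
    (hD : ∀ x, selfConv A x ≤ D) : ∫ x, selfConv A x * kernel x ≤ 44 * D := by
  have h := intervalIntegral_selfConv_mul hA kernel
  simp only [smul_eq_mul] at h
  rw [← h, ← integral_kernel, mul_comm, ← intervalIntegral.integral_const_mul]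
  have h1 : (-1 : ℝ) ≤ 1 := by norm_num
  rw [intervalIntegral.integral_of_le h1, intervalIntegral.integral_of_le h1]
  refine integral_mono_of_nonneg
    (.of_forall fun x => mul_nonneg (selfConv_nonneg A x) (kernel_nonneg x))
    ((continuous_const.mul continuous_kernel).integrableOn_Ioc) (.of_forall fun x => ?_)
  exact mul_le_mul_of_nonneg_right (hD x) (kernel_nonneg x)

lemma sum_norm_pow_four_le_of_bound {A : Set ℝ} (hm : MeasurableSet A)
    (hA : A ⊆ Set.Ico (-1 / 2) (1 / 2)) (hfin : volume A ≠ ⊤) {D : ℝ}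
    (hD : ∀ x, selfConv A x ≤ D) :
    volume.real A ^ 4 + 2 * (‖∫ t in A, wave 1 t‖ ^ 4 + ‖∫ t in A, wave 2 t‖ ^ 4
      + ‖∫ t in A, wave 3 t‖ ^ 4 + ‖∫ t in A, wave 4 t‖ ^ 4 + ‖∫ t in A, wave 5 t‖ ^ 4)
      ≤ 2 * D * volume.real A ^ 2 := by
  have h := sum_norm_pow_four_le hm hA hfin (Finset.Icc (-5) 5)
  have h2 := integral_selfConv_sq_le hm hA hfin hD
  have hs : (Finset.Icc (-5) 5 : Finset ℤ) = {-5, -4, -3, -2, -1, 0, 1, 2, 3, 4, 5} := by rfl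
  have h0 : ‖∫ t in A, wave 0 t‖ = volume.real A := by
    rw [integral_wave_zero, Complex.norm_real, Real.norm_of_nonneg measureReal_nonneg]
  rw [hs] at h
  simp [norm_integral_wave_neg, h0] at h
  linarith

lemma mul_sq_le_of_selfConv_le {A : Set ℝ} (hm : MeasurableSet A)
    (hA : A ⊆ Set.Ico (-1 / 2) (1 / 2)) (hfin : volume A ≠ ⊤) (hpos : 0 < volume.real A) {D : ℝ}
    (hD : ∀ x, selfConv A x ≤ D) : 0.591389 * volume.real A ^ 2 ≤ D := by
  have hK := integral_selfConv_mul_kernel_le hA hD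
  rw [integral_selfConv_mul_kernel hm hfin] at hK
  have hG := sum_re_integral_wave_ge hm hA hfin
  have hB := sum_norm_pow_four_le_of_bound hm hA hfin hD
  have h4 : ∀ z : ℂ, ‖z‖ ^ 4 = (z.re ^ 2 + z.im ^ 2) ^ 2 := fun z => by
    rw [show ‖z‖ ^ 4 = (‖z‖ ^ 2) ^ 2 by ring, Complex.sq_norm, Complex.normSq_apply]
    ring
  have h2 : ∀ z : ℂ, (z ^ 2).re = z.re ^ 2 - z.im ^ 2 := fun z => by
    simp [sq]
  simp only [h4] at hB
  simp only [h2] at hK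
  generalize volume.real A = ε at *
  generalize (∫ t in A, wave 1 t) = z₁ at *
  generalize (∫ t in A, wave 2 t) = z₂ at *
  generalize (∫ t in A, wave 3 t) = z₃ at *
  generalize (∫ t in A, wave 4 t) = z₄ at *
  generalize (∫ t in A, wave 5 t) = z₅ at *
  have ha : ∀ k g x : ℝ, 0 < k →
      x * g * ε / 6 - g ^ 2 / k * ε ^ 2 / 144 ≤ k * x ^ 2 := fun k g x hk => by
    have h : 0 ≤ k * (x - g * ε / (12 * k)) ^ 2 := by positivity
    have h' : k * (x - g * ε / (12 * k)) ^ 2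
        = k * x ^ 2 - (x * g * ε / 6 - g ^ 2 / k * ε ^ 2 / 144) := by
      field_simp
      ring
    linarith
  have hu : ∀ k x y : ℝ, k * (x ^ 2 + y ^ 2) * ε ^ 2
      ≤ k ^ 2 * ε ^ 4 / 364 + 91 * (x ^ 2 + y ^ 2) ^ 2 := fun k x y => by
    linarith [sq_nonneg (x ^ 2 + y ^ 2 - k * ε ^ 2 / 182)]
  have hlow : 10.44 * ε ^ 2 ≤ 39 * z₁.re ^ 2 + 30 * z₂.re ^ 2 + 21 * z₃.re ^ 2 + 12 * z₄.re ^ 2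
      + 4 * z₅.re ^ 2 := by
    have h1 := ha 39 207 z₁.re (by norm_num)
    have h2 := ha 30 (-98) z₂.re (by norm_num)
    have h3 := ha 21 1 z₃.re (by norm_num)
    have h4 := ha 12 28 z₄.re (by norm_num)
    have h5 := ha 4 (-12) z₅.re (by norm_num)
    have h6 := mul_le_mul_of_nonneg_right hG hpos.le
    linarith [sq_nonneg ε]
  have hmain : 0.591389 * ε ^ 2 * ε ^ 2 ≤ D * ε ^ 2 := by
    have h1 := hu 39 z₁.re z₁.im
    have h2 := hu 30 z₂.re z₂.im
    have h3 := hu 21 z₃.re z₃.im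
    have h4 := hu 12 z₄.re z₄.im
    have h5 := hu 4 z₅.re z₅.im
    have h6 := mul_le_mul_of_nonneg_right hlow (sq_nonneg ε)
    have h7 := mul_le_mul_of_nonneg_right hK (sq_nonneg ε)
    have h8 : 0 ≤ ε ^ 4 := by positivity
    linarith
  exact le_of_mul_le_mul_right hmain (by positivity)

lemma volume_real_inter_reflect_le_DD {A : Set ℝ} (hm : MeasurableSet A) (hfin : volume A ≠ ⊤)
    (x : ℝ) : volume.real (A ∩ {t | x - t ∈ A}) ≤ DD A := by
  refine le_csSup ⟨volume.real A, ?_⟩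
    ⟨_, Set.inter_subset_left, measurableSet_inter_reflect hm x, ⟨x / 2, fun y => ?_⟩, rfl⟩
  · rintro _ ⟨C, hC, -, -, rfl⟩
    exact measureReal_mono hC hfin
  · simp only [Set.mem_inter_iff, Set.mem_ofPred_eq]
    rw [show x - (x / 2 + y) = x / 2 - y by ring, show x - (x / 2 - y) = x / 2 + y by ring, and_comm]

lemma mul_sq_le_DD {A : Set ℝ} (hm : MeasurableSet A) (hA : A ⊆ Set.Ico 0 1)
    (hpos : 0 < volume.real A) : 0.591389 * volume.real A ^ 2 ≤ DD A := by
  have hfin : volume A ≠ ⊤ := ((measure_mono hA).trans_lt (by simp)).ne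
  have hvol : ∀ S : Set ℝ, volume ((fun t => t + 1 / 2) ⁻¹' S) = volume S :=
    fun S => measure_preimage_add_right _ _ _
  have hreal : volume.real ((fun t => t + 1 / 2) ⁻¹' A) = volume.real A := by
    simp only [measureReal_def, hvol]
  rw [← hreal] at hpos ⊢
  refine mul_sq_le_of_selfConv_le (hm.preimage (by fun_prop)) (fun t ht => ?_)
    (by rwa [hvol]) hpos fun x => ?_
  · obtain ⟨h1, h2⟩ := hA ht
    exact ⟨by linarith, by linarith⟩
  · refine le_trans (le_of_eq ?_) (volume_real_inter_reflect_le_DD hm hfin (x + 1))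
    rw [selfConv, measureReal_def, measureReal_def, ← hvol (A ∩ _)]
    congr 2
    ext t
    simp only [Set.mem_inter_iff, Set.mem_preimage, Set.mem_ofPred_eq]
    rw [show x - t + 1 / 2 = x + 1 - (t + 1 / 2) by ring]

theorem full_delta_bound (ε : ℝ) (hε0 : 0 < ε) (hε1 : ε ≤ 1) :
    0.591389 * ε^2 ≤ Δ ε := by
  refine le_csInf ⟨_, Set.Ico 0 ε, Set.Ico_subset_Ico_right hε1, measurableSet_Ico, by simp, rfl⟩ ?_
  rintro _ ⟨A, hA, hm, hvol, rfl⟩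
  have hreal : volume.real A = ε := by
    rw [measureReal_def, hvol, ENNReal.toReal_ofReal hε0.le]
  simpa only [hreal] using mul_sq_le_DD hm hA (by rwa [hreal])
end

section
/- For every 0 < ε ≤ 1, Δ_𝕋(ε) = ε². In particular, every measurable subset A of the circle 𝕋 with Haar measure λ(A) = ε satisfies D_𝕋(A) ≥ ε². -/
open MeasureTheory

/-- A subset of the circle is symmetric if some reflection fixes it. -/
def IsSymmetricSetT (C : Set UnitAddCircle) : Prop :=
  ∃ c : UnitAddCircle, ∀ t : UnitAddCircle, c + t ∈ C ↔ c - t ∈ C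

/-- `DT A` is the supremum of measures of measurable symmetric subsets of `A ⊆ 𝕋`. -/
noncomputable def DT (A : Set UnitAddCircle) : ℝ :=
  sSup {m : ℝ | ∃ C : Set UnitAddCircle, C ⊆ A ∧ MeasurableSet C ∧ IsSymmetricSetT C ∧
    m = (volume C).toReal}

/-- `ΔT ε` is the infimum of `DT A` over measurable `A ⊆ 𝕋` of measure `ε`. -/
noncomputable def ΔT (ε : ℝ) : ℝ :=
  sInf {d : ℝ | ∃ A : Set UnitAddCircle, MeasurableSet A ∧ volume A = ENNReal.ofReal ε ∧
    d = DT A}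

open Set Filter Topology Metric
open scoped Pointwise

instance : IsProbabilityMeasure (volume : Measure UnitAddCircle) := ⟨UnitAddCircle.measure_univ⟩

theorem volume_nsmul_preimage {N : ℕ} (hN : N ≠ 0) {B : Set UnitAddCircle}
    (hB : MeasurableSet B) : volume ((fun x : UnitAddCircle => N • x) ⁻¹' B) = volume B := by
  have h := Measure.measurePreserving_zsmul (volume : Measure UnitAddCircle)
    (Int.natCast_ne_zero.2 hN)
  simpa using h.measure_preimage hB.nullMeasurableSet

/-- If `k ∣ N`, then `{x | N • x ∈ B}` has the same measure in every ball of measure `1 / k`. -/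
theorem mul_volume_nsmul_preimage_inter_ball {k N : ℕ} (hk : 0 < k) (hN : N ≠ 0) (hkN : k ∣ N)
    {B : Set UnitAddCircle} (hB : MeasurableSet B) (x : UnitAddCircle) :
    k * volume ((fun x : UnitAddCircle => N • x) ⁻¹' B ∩ ball x (1 / (2 * k))) = volume B := by
  rw [← volume_nsmul_preimage hN hB]
  set u : UnitAddCircle := ((1 / k : ℝ) : UnitAddCircle)
  have hord : addOrderOf u = k := AddCircle.addOrderOf_period_div hk
  have hNu : N • u = 0 := addOrderOf_dvd_iff_nsmul_eq_zero.1 (hord ▸ hkN)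
  have hfin : IsOfFinAddOrder u := addOrderOf_pos_iff.1 (hord ▸ hk)
  have hinv : u +ᵥ ((fun x : UnitAddCircle => N • x) ⁻¹' B)
      = (fun x : UnitAddCircle => N • x) ⁻¹' B := by
    ext y
    rw [mem_vadd_set_iff_neg_vadd_mem]
    simp [smul_add, hNu]
  have h := AddCircle.volume_of_add_preimage_eq ((fun x : UnitAddCircle => N • x) ⁻¹' B)
    (ball x (1 / (2 * k))) u x hfin (by rw [hinv]; exact ae_eq_rfl) (by rw [hord]; exact ae_eq_rfl)
  rw [h, hord, nsmul_eq_mul]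

/-- A set `F` that is almost invariant under small translations is almost independent of
`{x | N • x ∈ B}`. -/
theorem measure_inter_nsmul_preimage_le {F B : Set UnitAddCircle}
    (hB : MeasurableSet B) {N : ℕ} (hN : N ≠ 0) {δ : ENNReal}
    (h : ∀ t ∈ ball (0 : UnitAddCircle) (1 / (2 * N)),
      volume (F \ (fun x => x + t) ⁻¹' F) ≤ δ) :
    volume (F ∩ (fun x : UnitAddCircle => N • x) ⁻¹' B) ≤ volume B * volume F + δ := by
  set G := (fun x : UnitAddCircle => N • x) ⁻¹' B with hG
  set V := ball (0 : UnitAddCircle) (1 / (2 * N)) with hV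
  have hGm : MeasurableSet G := (continuous_nsmul N).measurable hB
  have hVm : MeasurableSet V := measurableSet_ball
  have hNV : N * volume V = 1 := by
    simpa [hV] using mul_volume_nsmul_preimage_inter_ball (Nat.pos_of_ne_zero hN) hN dvd_rfl
      MeasurableSet.univ (0 : UnitAddCircle)
  have hball (y : UnitAddCircle) : N * volume (V ∩ (fun t => y - t) ⁻¹' G) = volume B := by
    rw [← mul_volume_nsmul_preimage_inter_ball (Nat.pos_of_ne_zero hN) hN dvd_rfl hB y, ← hG,
      ← (Measure.measurePreserving_sub_left volume y).measure_preimage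
        (hGm.inter measurableSet_ball).nullMeasurableSet]
    congr 2
    ext t
    simp [hV, and_comm, dist_eq_norm]
  have hle : ∀ t ∈ V, volume (F ∩ G) ≤ δ + volume (F ∩ (fun y => y - t) ⁻¹' G) := by
    intro t ht
    have hsub : F ∩ G ⊆ (F \ (fun x => x + t) ⁻¹' F) ∪
        (fun x => x + t) ⁻¹' (F ∩ (fun y => y - t) ⁻¹' G) := by
      intro x hx
      by_cases hxt : x + t ∈ F
      · exact Or.inr ⟨hxt, by simpa using hx.2⟩
      · exact Or.inl ⟨hx.1, hxt⟩
    refine (measure_mono hsub).trans ((measure_union_le _ _).trans (add_le_add (h t ht) ?_))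
    rw [measure_preimage_add_right]
  have hswap : ∫⁻ t in V, volume (F ∩ (fun y => y - t) ⁻¹' G)
      = ∫⁻ y in F, volume (V ∩ (fun t => y - t) ⁻¹' G) := by
    have hind (t : UnitAddCircle) : volume (F ∩ (fun y => y - t) ⁻¹' G)
        = ∫⁻ y in F, G.indicator 1 (y - t) := by
      rw [inter_comm, ← Measure.restrict_apply ((measurable_sub_const t) hGm),
        ← lintegral_indicator_one ((measurable_sub_const t) hGm)]
      rfl
    have hind' (y : UnitAddCircle) : volume (V ∩ (fun t => y - t) ⁻¹' G)
        = ∫⁻ t in V, G.indicator 1 (y - t) := by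
      rw [inter_comm, ← Measure.restrict_apply ((measurable_const_sub y) hGm),
        ← lintegral_indicator_one ((measurable_const_sub y) hGm)]
      rfl
    simp_rw [hind, hind']
    refine lintegral_lintegral_swap (Measurable.aemeasurable ?_)
    exact (measurable_one.indicator hGm).comp (measurable_snd.sub measurable_fst)
  calc volume (F ∩ G) = N * ∫⁻ _ in V, volume (F ∩ G) := by
        rw [setLIntegral_const, mul_left_comm, hNV, mul_one]
    _ ≤ N * ∫⁻ t in V, (δ + volume (F ∩ (fun y => y - t) ⁻¹' G)) := by
        gcongr 1
        exact setLIntegral_mono' hVm hle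
    _ = δ + ∫⁻ y in F, N * volume (V ∩ (fun t => y - t) ⁻¹' G) := by
        rw [lintegral_add_left measurable_const, hswap, setLIntegral_const, mul_add,
          mul_left_comm, hNV, mul_one, lintegral_const_mul' _ _ (ENNReal.natCast_ne_top N)]
    _ = volume B * volume F + δ := by
        simp_rw [hball]
        rw [setLIntegral_const, add_comm]

theorem eventually_measure_diff_translate_le {P : Set UnitAddCircle} (hP : MeasurableSet P)
    {δ : ENNReal} (hδ : 0 < δ) :
    ∀ᶠ t in 𝓝 (0 : UnitAddCircle), volume (P \ (fun x => x + t) ⁻¹' P) ≤ δ := by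
  let f : C(UnitAddCircle, C(UnitAddCircle, UnitAddCircle)) :=
    ContinuousMap.curry ⟨fun p => p.2 + p.1, by fun_prop⟩
  have h := tendsto_measure_symmDiff_preimage_nhds_zero (μ := volume) (ν := volume)
    (f.continuous.tendsto 0)
    (Eventually.of_forall fun t => measurePreserving_add_right volume t)
    (measurePreserving_add_right volume 0) hP.nullMeasurableSet (measure_ne_top _ _)
  filter_upwards [ENNReal.tendsto_nhds_zero.1 h δ hδ] with t ht
  refine (measure_mono ?_).trans ht
  intro x hx
  exact Or.inr ⟨by simpa [f] using hx.1, hx.2⟩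

theorem eventually_measure_inter_nsmul_preimage_le {P Q : Set UnitAddCircle}
    (hP : MeasurableSet P) (hQ : MeasurableSet Q) {δ : ENNReal} (hδ : 0 < δ) :
    ∀ᶠ N : ℕ in atTop, ∀ (s : UnitAddCircle) (B : Set UnitAddCircle), MeasurableSet B →
      volume (P ∩ (fun x => s - x) ⁻¹' Q ∩ (fun x : UnitAddCircle => N • x) ⁻¹' B)
        ≤ volume B * volume (P ∩ (fun x => s - x) ⁻¹' Q) + δ := by
  have hδ2 : 0 < δ / 2 := ENNReal.half_pos hδ.ne'
  have hneg : Tendsto (fun t : UnitAddCircle => -t) (𝓝 0) (𝓝 0) := by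
    simpa using (continuous_neg (G := UnitAddCircle)).tendsto 0
  obtain ⟨r, hr, hball⟩ := Metric.eventually_nhds_iff_ball.1
    ((eventually_measure_diff_translate_le hP hδ2).and
      (hneg.eventually (eventually_measure_diff_translate_le hQ hδ2)))
  obtain ⟨M, hM⟩ := exists_nat_gt (1 / r)
  filter_upwards [eventually_ge_atTop M, eventually_gt_atTop 0] with N hMN hN s B hB
  have hNr : 1 / (2 * (N : ℝ)) ≤ r := by
    have h1 : 1 / r < N := hM.trans_le (by exact_mod_cast hMN)
    rw [div_lt_iff₀ hr] at h1
    have hN' : (0 : ℝ) < N := by exact_mod_cast hN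
    rw [div_le_iff₀ (by positivity)]
    nlinarith
  refine measure_inter_nsmul_preimage_le hB hN.ne' ?_
  intro t ht
  obtain ⟨h1, h2⟩ := hball t (ball_subset_ball hNr ht)
  have hsub : (P ∩ (fun x => s - x) ⁻¹' Q) \ (fun x => x + t) ⁻¹' (P ∩ (fun x => s - x) ⁻¹' Q)
      ⊆ (P \ (fun x => x + t) ⁻¹' P) ∪ (fun x => s - x) ⁻¹' (Q \ (fun x => x + -t) ⁻¹' Q) := by
    rintro x ⟨⟨hxP, hxQ⟩, hx⟩
    by_cases hxt : x + t ∈ P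
    · refine Or.inr ⟨hxQ, fun hQ' => hx ⟨hxt, ?_⟩⟩
      simpa [sub_sub, ← sub_eq_add_neg] using hQ'
    · exact Or.inl ⟨hxP, hxt⟩
  refine (measure_mono hsub).trans ((measure_union_le _ _).trans ?_)
  rw [(Measure.measurePreserving_sub_left volume s).measure_preimage
    (hQ.diff (measurable_add_const _ hQ)).nullMeasurableSet]
  exact (add_le_add h1 h2).trans (ENNReal.add_halves δ).le

theorem volume_inter_reflection_comm {P Q : Set UnitAddCircle} (hP : MeasurableSet P)
    (hQ : MeasurableSet Q) (s : UnitAddCircle) :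
    volume (P ∩ (fun x => s - x) ⁻¹' Q) = volume (Q ∩ (fun x => s - x) ⁻¹' P) := by
  rw [← (Measure.measurePreserving_sub_left volume s).measure_preimage
    (hP.inter (measurable_const_sub s hQ)).nullMeasurableSet]
  congr 1
  ext x
  simp [and_comm]

theorem disjoint_ball_nsmul {k : ℕ} (hk : 0 < k) {i j : ℕ} (hi : i < k) (hj : j < k)
    (hij : i ≠ j) :
    Disjoint (ball (i • ((1 / k : ℝ) : UnitAddCircle)) (1 / (2 * k)))
      (ball (j • ((1 / k : ℝ) : UnitAddCircle)) (1 / (2 * k))) := by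
  set u : UnitAddCircle := ((1 / k : ℝ) : UnitAddCircle)
  have hord : addOrderOf u = k := AddCircle.addOrderOf_period_div hk
  have hk' : (0 : ℝ) < k := by exact_mod_cast hk
  set v := i • u - j • u with hv
  have hv0 : v ≠ 0 := fun h => hij <|
    nsmul_injOn_Iio_addOrderOf (by simpa [hord] using hi) (by simpa [hord] using hj)
      (sub_eq_zero.1 h)
  have hkv : k • v = 0 := by
    have hku : k • u = 0 := by rw [← hord]; exact addOrderOf_nsmul_eq_zero u
    rw [hv, nsmul_sub, nsmul_left_comm, nsmul_left_comm u j k, hku]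
    simp
  have hfin : IsOfFinAddOrder v := isOfFinAddOrder_iff_nsmul_eq_zero.2 ⟨k, hk, hkv⟩
  have hle : (addOrderOf v : ℝ) ≤ k := by
    exact_mod_cast Nat.le_of_dvd hk (addOrderOf_dvd_of_nsmul_eq_zero hkv)
  have h := AddCircle.le_add_order_smul_norm_of_isOfFinAddOrder hfin hv0
  rw [nsmul_eq_mul] at h
  apply ball_disjoint_ball
  rw [dist_eq_norm, ← hv]
  have h' : 1 ≤ k * ‖v‖ := h.trans (by gcongr)
  have : (1 : ℝ) / (2 * k) + 1 / (2 * k) = 1 / k := by field_simp; norm_num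
  rw [this, div_le_iff₀ hk']
  linarith

/-- Points `x` such that `x` and `s - x` both lie in one ball of radius `1 / (2 * k)` satisfy
`‖2 • x - s‖ ≤ 1 / k`. -/
theorem sum_volume_ball_inter_reflection_le {k : ℕ} (hk : 0 < k) {ι : Type*} [Fintype ι]
    (c : ι → UnitAddCircle)
    (hc : Pairwise fun i j => Disjoint (ball (c i) (1 / (2 * k))) (ball (c j) (1 / (2 * k))))
    (s : UnitAddCircle) :
    ∑ i, volume (ball (c i) (1 / (2 * k)) ∩ (fun x => s - x) ⁻¹' ball (c i) (1 / (2 * k)))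
      ≤ ENNReal.ofReal (2 / k) := by
  have hk' : (0 : ℝ) < k := by exact_mod_cast hk
  rw [← tsum_fintype (L := .unconditional ι), ← measure_iUnion
    (fun i j hij => (hc hij).mono inter_subset_left inter_subset_left)
    (fun i => measurableSet_ball.inter (measurable_const_sub s measurableSet_ball))]
  have hsub : (⋃ i, ball (c i) (1 / (2 * k)) ∩ (fun x => s - x) ⁻¹' ball (c i) (1 / (2 * k)))
      ⊆ (fun x : UnitAddCircle => 2 • x) ⁻¹' closedBall s (1 / k) := by
    refine iUnion_subset fun i x hx => ?_
    have h := (dist_triangle_right x (s - x) (c i)).trans (add_lt_add hx.1 hx.2).le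
    have h2 : (1 : ℝ) / (2 * k) + 1 / (2 * k) = 1 / k := by field_simp; norm_num
    rw [h2, dist_eq_norm] at h
    rw [mem_preimage, mem_closedBall, dist_eq_norm]
    rwa [show 2 • x - s = x - (s - x) by rw [two_nsmul]; abel]
  refine (measure_mono hsub).trans ?_
  rw [volume_nsmul_preimage two_ne_zero measurableSet_closedBall, AddCircle.volume_closedBall]
  exact ENNReal.ofReal_le_ofReal ((min_le_right _ _).trans_eq (by ring))

/-- There is a set with the measure of `B` that meets each of its reflections almost as little as
independence would give. It is `⋃ i, I i ∩ {x | N i • x ∈ B}` for disjoint balls `I i` of measure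
`1 / k` and a rapidly increasing sequence `N` of multiples of `k`. -/
theorem exists_volume_inter_reflection_le {B : Set UnitAddCircle} (hB : MeasurableSet B)
    {η : ENNReal} (hη : 0 < η) :
    ∃ A : Set UnitAddCircle, MeasurableSet A ∧ volume A = volume B ∧
      ∀ s : UnitAddCircle, volume (A ∩ (fun x => s - x) ⁻¹' A) ≤ volume B ^ 2 + η := by
  have hη2 : 0 < η / 2 := ENNReal.half_pos hη.ne'
  obtain ⟨k, hkη, hk⟩ : ∃ k : ℕ, ENNReal.ofReal (2 / k) ≤ η / 2 ∧ 0 < k := by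
    have h := ENNReal.tendsto_ofReal (tendsto_const_div_atTop_nhds_zero_nat (2 : ℝ))
    rw [ENNReal.ofReal_zero] at h
    exact ((ENNReal.tendsto_nhds_zero.1 h _ hη2).and (eventually_gt_atTop 0)).exists
  have hk0 : (k : ENNReal) ≠ 0 := by exact_mod_cast hk.ne'
  set δ : ENNReal := η / 2 / (2 * k ^ 2)
  have hδ : 0 < δ := ENNReal.div_pos hη2.ne' (by finiteness)
  have hδk : 2 * (k : ENNReal) ^ 2 * δ = η / 2 :=
    ENNReal.mul_div_cancel (by simp [hk0]) (by finiteness)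
  set c : Fin k → UnitAddCircle := fun i => (i : ℕ) • ((1 / k : ℝ) : UnitAddCircle)
  set I : Fin k → Set UnitAddCircle := fun i => ball (c i) (1 / (2 * k))
  have hIm (i : Fin k) : MeasurableSet (I i) := measurableSet_ball
  have hId : Pairwise fun i j => Disjoint (I i) (I j) := fun i j hij =>
    disjoint_ball_nsmul hk i.2 j.2 (Fin.val_injective.ne hij)
  set G : ℕ → Set UnitAddCircle := fun n => (fun x : UnitAddCircle => n • x) ⁻¹' B with hG
  have hGm (n : ℕ) : MeasurableSet (G n) := (continuous_nsmul n).measurable hB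
  obtain ⟨N, hN, hNlt⟩ := exists_seq_of_forall_finset_exists
    (fun n : ℕ => n ≠ 0 ∧ k ∣ n ∧ ∀ (i j : Fin k) (s : UnitAddCircle) (B' : Set UnitAddCircle),
      MeasurableSet B' → volume (I i ∩ (fun x => s - x) ⁻¹' I j ∩
        (fun x : UnitAddCircle => n • x) ⁻¹' B')
          ≤ volume B' * volume (I i ∩ (fun x => s - x) ⁻¹' I j) + δ)
    (fun n m : ℕ => ∀ (i j : Fin k) (s : UnitAddCircle) (B' : Set UnitAddCircle),
      MeasurableSet B' → volume (I i ∩ G n ∩ (fun x => s - x) ⁻¹' I j ∩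
        (fun x : UnitAddCircle => m • x) ⁻¹' B')
          ≤ volume B' * volume (I i ∩ G n ∩ (fun x => s - x) ⁻¹' I j) + δ)
    (by
      intro S _
      have h1 := eventually_all.2 fun i => eventually_all.2 fun j =>
        eventually_measure_inter_nsmul_preimage_le (hIm i) (hIm j) hδ
      have h2 := (Filter.eventually_all_finset S).2 fun n _ => eventually_all.2 fun i =>
        eventually_all.2 fun j =>
          eventually_measure_inter_nsmul_preimage_le ((hIm i).inter (hGm n)) (hIm j) hδ
      obtain ⟨M, hM⟩ := eventually_atTop.1 (h1.and h2)
      have hkM : M ≤ k * (M + 1) := by nlinarith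
      exact ⟨k * (M + 1), ⟨by positivity, dvd_mul_right _ _, (hM _ hkM).1⟩, (hM _ hkM).2⟩)
  set a : Fin k → Set UnitAddCircle := fun i => I i ∩ G (N i) with ha
  have ham (i : Fin k) : MeasurableSet (a i) := (hIm i).inter (hGm _)
  have haI (i : Fin k) : a i ⊆ I i := inter_subset_left
  refine ⟨⋃ i, a i, .iUnion ham, ?_, fun s => ?_⟩
  · rw [measure_iUnion (fun i j hij => (hId hij).mono (haI i) (haI j)) ham, tsum_fintype]
    have hvol (i : Fin k) : volume (a i) = volume B / k := by
      rw [ENNReal.eq_div_iff hk0 (ENNReal.natCast_ne_top k),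
        show a i = G (N i) ∩ I i from inter_comm _ _]
      exact mul_volume_nsmul_preimage_inter_ball hk (hN i).1 (hN i).2.1 hB (c i)
    simp_rw [hvol]
    rw [Finset.sum_const, Finset.card_univ, Fintype.card_fin, nsmul_eq_mul,
      ENNReal.mul_div_cancel hk0 (ENNReal.natCast_ne_top k)]
  set W : Fin k → Fin k → Set UnitAddCircle := fun i j => I i ∩ (fun x => s - x) ⁻¹' I j with hW
  have hWm (i j : Fin k) : MeasurableSet (W i j) := (hIm i).inter (measurable_const_sub s (hIm j))
  have hlt {i j : Fin k} (hij : i < j) :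
      volume (a i ∩ (fun x => s - x) ⁻¹' a j) ≤ volume B ^ 2 * volume (W i j) + 2 * δ := by
    have hpre := (Measure.measurePreserving_sub_left volume (N j • s)).measure_preimage
      hB.nullMeasurableSet
    have h1 := (hN i).2.2 i j s B hB
    have h2 := hNlt i j hij i j s _ (measurable_const_sub (N j • s) hB)
    rw [hpre] at h2
    have heq : a i ∩ (fun x => s - x) ⁻¹' a j = I i ∩ G (N i) ∩ (fun x => s - x) ⁻¹' I j ∩
        (fun x : UnitAddCircle => N j • x) ⁻¹' ((fun x => N j • s - x) ⁻¹' B) := by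
      ext x
      simp [ha, hG, nsmul_sub, and_assoc]
    rw [inter_right_comm] at h1
    calc volume (a i ∩ (fun x => s - x) ⁻¹' a j)
        ≤ volume B * (volume B * volume (W i j) + δ) + δ := by
          rw [heq]
          refine h2.trans ?_
          gcongr
      _ = volume B ^ 2 * volume (W i j) + (volume B * δ + δ) := by ring
      _ ≤ volume B ^ 2 * volume (W i j) + 2 * δ := by
          rw [two_mul]
          gcongr
          exact mul_le_of_le_one_left' prob_le_one
  have hbound (i j : Fin k) : volume (a i ∩ (fun x => s - x) ⁻¹' a j)
      ≤ volume B ^ 2 * volume (W i j) + 2 * δ + if i = j then volume (W i j) else 0 := by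
    rcases lt_trichotomy i j with h | rfl | h
    · exact (hlt h).trans le_self_add
    · rw [if_pos rfl]
      exact (measure_mono (inter_subset_inter (haI i) (preimage_mono (haI i)))).trans le_add_self
    · rw [volume_inter_reflection_comm (ham i) (ham j), hW,
        volume_inter_reflection_comm (hIm i) (hIm j)]
      exact (hlt h).trans le_self_add
  have hWsum : ∑ i, ∑ j, volume (W i j) ≤ 1 := by
    rw [← Fintype.sum_prod_type' (f := fun i j => volume (W i j)),
      ← tsum_fintype (L := .unconditional _),
      ← measure_iUnion _ (fun p : Fin k × Fin k => hWm p.1 p.2)]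
    · exact prob_le_one
    · rintro ⟨i, j⟩ ⟨i', j'⟩ hne
      by_cases hi : i = i'
      · have hj : j ≠ j' := fun hj => hne (by rw [hi, hj])
        exact ((hId hj).preimage _).mono inter_subset_right inter_subset_right
      · exact (hId hi).mono inter_subset_left inter_subset_left
  have hunion : (⋃ i, a i) ∩ (fun x => s - x) ⁻¹' (⋃ i, a i)
      = ⋃ i, ⋃ j, a i ∩ (fun x => s - x) ⁻¹' a j := by
    rw [preimage_iUnion, iUnion_inter_iUnion]
  calc volume ((⋃ i, a i) ∩ (fun x => s - x) ⁻¹' (⋃ i, a i))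
      ≤ ∑ i, ∑ j, volume (a i ∩ (fun x => s - x) ⁻¹' a j) := by
        rw [hunion]
        refine (measure_iUnion_fintype_le _ _).trans (Finset.sum_le_sum fun i _ => ?_)
        exact measure_iUnion_fintype_le _ _
    _ ≤ ∑ i, ∑ j, (volume B ^ 2 * volume (W i j) + 2 * δ +
          if i = j then volume (W i j) else 0) :=
        Finset.sum_le_sum fun i _ => Finset.sum_le_sum fun j _ => hbound i j
    _ = volume B ^ 2 * (∑ i, ∑ j, volume (W i j)) + 2 * k ^ 2 * δ + ∑ i, volume (W i i) := by
        simp [Finset.sum_add_distrib, ← Finset.mul_sum]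
        ring
    _ ≤ volume B ^ 2 * 1 + η / 2 + η / 2 := by
        rw [hδk]
        gcongr
        exact (sum_volume_ball_inter_reflection_le hk c hId s).trans hkη
    _ = volume B ^ 2 + η := by rw [mul_one, add_assoc, ENNReal.add_halves]

theorem volume_toReal_le_DT {A C : Set UnitAddCircle} (hCA : C ⊆ A) (hC : MeasurableSet C)
    (hsymm : IsSymmetricSetT C) : (volume C).toReal ≤ DT A := by
  refine le_csSup ⟨1, ?_⟩ ⟨C, hCA, hC, hsymm, rfl⟩
  rintro _ ⟨C, -, -, -, rfl⟩
  exact measureReal_le_one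

/-- On average over `s`, the sets `A` and `s - A` meet in measure `(volume A) ^ 2`. -/
theorem sq_volume_toReal_le_DT {A : Set UnitAddCircle} (hA : MeasurableSet A) :
    (volume A).toReal ^ 2 ≤ DT A := by
  have hint : ∫⁻ s : UnitAddCircle, volume (A ∩ (fun x => s - x) ⁻¹' A) = volume A ^ 2 := by
    have hind (s : UnitAddCircle) : volume (A ∩ (fun x => s - x) ⁻¹' A)
        = ∫⁻ x in A, A.indicator 1 (s - x) := by
      rw [inter_comm, ← Measure.restrict_apply ((measurable_const_sub s) hA),
        ← lintegral_indicator_one ((measurable_const_sub s) hA)]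
      rfl
    simp_rw [hind]
    have hmeas : Measurable (Function.uncurry fun s x : UnitAddCircle =>
        A.indicator (1 : UnitAddCircle → ENNReal) (s - x)) :=
      (measurable_one.indicator hA).comp (measurable_fst.sub measurable_snd)
    rw [lintegral_lintegral_swap hmeas.aemeasurable]
    have hx (x : UnitAddCircle) :
        ∫⁻ s : UnitAddCircle, A.indicator (1 : UnitAddCircle → ENNReal) (s - x)
        = volume A := by
      rw [lintegral_sub_right_eq_self (fun s => A.indicator (1 : UnitAddCircle → ENNReal) s) x,
        lintegral_indicator_one hA]
    simp_rw [hx]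
    rw [setLIntegral_const, sq]
  obtain ⟨s, hs⟩ := exists_lintegral_le
    (μ := (volume : Measure UnitAddCircle)) (f := fun s => volume (A ∩ (fun x => s - x) ⁻¹' A))
    (by rw [hint]; finiteness)
  rw [hint] at hs
  obtain ⟨r, rfl⟩ := QuotientAddGroup.mk_surjective s
  set c : UnitAddCircle := ((r / 2 : ℝ) : UnitAddCircle) with hc
  have hcc : (QuotientAddGroup.mk r : UnitAddCircle) = c + c := by
    rw [hc, ← AddCircle.coe_add, add_halves]
  rw [hcc] at hs
  rw [← ENNReal.toReal_pow]
  refine (ENNReal.toReal_mono (measure_ne_top _ _) hs).trans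
    (volume_toReal_le_DT inter_subset_left (hA.inter (measurable_const_sub _ hA)) ⟨c, fun t => ?_⟩)
  have h1 : c + c - (c + t) = c - t := by abel
  have h2 : c + c - (c - t) = c + t := by abel
  simp [h1, h2, and_comm]

theorem DT_le {A : Set UnitAddCircle} {d : ℝ}
    (h : ∀ s : UnitAddCircle, (volume (A ∩ (fun x => s - x) ⁻¹' A)).toReal ≤ d) : DT A ≤ d := by
  refine csSup_le ⟨_, ∅, empty_subset _, .empty, ⟨0, by simp⟩, rfl⟩ ?_
  rintro _ ⟨C, hCA, -, ⟨c, hc⟩, rfl⟩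
  refine (ENNReal.toReal_mono (measure_ne_top _ _) (measure_mono fun x hx => ?_)).trans (h (c + c))
  refine ⟨hCA hx, hCA ?_⟩
  have := (hc (x - c)).1 (by simpa using hx)
  rwa [show c - (x - c) = c + c - x by abel] at this

theorem circle_answer (ε : ℝ) (hε0 : 0 < ε) (hε1 : ε ≤ 1) :
    ΔT ε = ε^2 ∧
    ∀ A : Set UnitAddCircle, MeasurableSet A → volume A = ENNReal.ofReal ε → ε^2 ≤ DT A := by
  have hlower : ∀ A : Set UnitAddCircle, MeasurableSet A → volume A = ENNReal.ofReal ε →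
      ε ^ 2 ≤ DT A := by
    intro A hA hAε
    simpa [hAε, ENNReal.toReal_ofReal hε0.le] using sq_volume_toReal_le_DT hA
  refine ⟨?_, hlower⟩
  rw [ΔT]
  have hB : volume (closedBall (0 : UnitAddCircle) (ε / 2)) = ENNReal.ofReal ε := by
    rw [AddCircle.volume_closedBall, mul_div_cancel₀ _ two_ne_zero, min_eq_right hε1]
  refine le_antisymm (le_of_forall_pos_le_add fun η hη => ?_) ?_
  · obtain ⟨A, hA, hAB, hle⟩ := exists_volume_inter_reflection_le
      (B := closedBall (0 : UnitAddCircle) (ε / 2)) measurableSet_closedBall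
      (ENNReal.ofReal_pos.2 hη)
    rw [hB] at hAB hle
    have hDT : DT A ≤ ε ^ 2 + η := by
      refine DT_le fun s => ENNReal.toReal_le_of_le_ofReal (by positivity) ?_
      rw [ENNReal.ofReal_add (by positivity) hη.le, ENNReal.ofReal_pow hε0.le]
      exact hle s
    refine le_trans (csInf_le ⟨ε ^ 2, ?_⟩ ⟨A, hA, hAB, rfl⟩) hDT
    rintro _ ⟨A, hA, hAε, rfl⟩
    exact hlower A hA hAε
  · refine le_csInf ⟨DT _, closedBall 0 (ε / 2), measurableSet_closedBall, hB, rfl⟩ ?_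
    rintro _ ⟨A, hA, hAε, rfl⟩
    exact hlower A hA hAε
end
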